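/- arXiv:math-ph/0602015 — 2 statements merged into one kernel-verified Lean document; each statement's English description precedes it below -/
import Mathlib

section
/- For the Gaussian probability measure dμ_h(Z) = e^{-Tr(Z*Z)/h} (πh)^{-N²} dZ on the space of N×N complex matrices, the monomial matrix functions satisfy ∫ Z^{*j} Z^k dμ_h(Z) = δ_{jk} h^k c_k I for some positive real constants c_k depending only on k and N (i.e., the matrix-valued integral is zero when j ≠ k, and a positive scalar multiple of the identity when j = k). -/
open MeasureTheory Matrix

section GaussianMonomials

variable {N : ℕ}

/-- The integrand of the matrix moment `∫ Z^{*j} Z^k dμ_h(Z)` at the entry `(a, b)`. -/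
noncomputable def gaussianMonomial (h : ℝ) (j k : ℕ) (a b : Fin N) (Z : Fin N → Fin N → ℂ) : ℂ :=
  (((Matrix.of Z)ᴴ ^ j * (Matrix.of Z) ^ k) a b) *
    Complex.ofReal (((Real.pi * h) ^ (N^2))⁻¹ *
      Real.exp (-(∑ p, ∑ q, Complex.normSq (Z p q)) / h))

/-- Entrywise multiplication by unit complex numbers. -/
noncomputable def entrywiseRotation (w : Fin N → Fin N → Circle) :
    (Fin N → Fin N → ℂ) ≃ᵐ (Fin N → Fin N → ℂ) :=
  MeasurableEquiv.piCongrRight fun p => MeasurableEquiv.piCongrRight fun q =>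
    (rotation (w p q)).toMeasurableEquiv

lemma entrywiseRotation_apply (w : Fin N → Fin N → Circle) (Z : Fin N → Fin N → ℂ) (p q : Fin N) :
    entrywiseRotation w Z p q = w p q * Z p q := rfl

lemma measurePreserving_entrywiseRotation (w : Fin N → Fin N → Circle) :
    MeasurePreserving (entrywiseRotation w) := by
  refine volume_preserving_pi (f := fun p (z : Fin N → ℂ) q => rotation (w p q) (z q)) fun p => ?_
  exact volume_preserving_pi (f := fun q => rotation (w p q)) fun q =>
    (rotation (w p q)).measurePreserving

/-- Simultaneous permutation of rows and columns. -/
noncomputable def simultaneousReindex (σ : Equiv.Perm (Fin N)) :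
    (Fin N → Fin N → ℂ) ≃ᵐ (Fin N → Fin N → ℂ) :=
  (MeasurableEquiv.piCongrRight fun _ => MeasurableEquiv.piCongrLeft (fun _ => ℂ) σ).trans
    (MeasurableEquiv.piCongrLeft (fun _ => Fin N → ℂ) σ)

lemma simultaneousReindex_apply (σ : Equiv.Perm (Fin N)) (Z : Fin N → Fin N → ℂ) (p q : Fin N) :
    simultaneousReindex σ Z p q = Z (σ.symm p) (σ.symm q) := by
  obtain ⟨p, rfl⟩ := σ.surjective p
  obtain ⟨q, rfl⟩ := σ.surjective q
  simp only [simultaneousReindex, MeasurableEquiv.trans_apply, MeasurableEquiv.coe_piCongrLeft,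
    Equiv.piCongrLeft_apply_apply, Equiv.symm_apply_apply]
  exact Equiv.piCongrLeft_apply_apply (P := fun _ => ℂ) σ (Z p) q

lemma measurePreserving_simultaneousReindex (σ : Equiv.Perm (Fin N)) :
    MeasurePreserving (simultaneousReindex σ) := by
  refine (volume_measurePreserving_piCongrLeft (fun _ => Fin N → ℂ) σ).comp ?_
  exact volume_preserving_pi
    (f := fun (_ : Fin N) => MeasurableEquiv.piCongrLeft (fun _ : Fin N => ℂ) σ)
    fun _ => volume_measurePreserving_piCongrLeft (fun _ => ℂ) σ

lemma integral_gaussianMonomial_eq_zero_of_rotation {h : ℝ} {j k : ℕ} {a b : Fin N}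
    (w : Fin N → Fin N → Circle)
    (hw : ∀ Z : Fin N → Fin N → ℂ,
      ((Matrix.of (entrywiseRotation w Z))ᴴ ^ j * (Matrix.of (entrywiseRotation w Z)) ^ k) a b =
        -(((Matrix.of Z)ᴴ ^ j * (Matrix.of Z) ^ k) a b)) :
    ∫ Z, gaussianMonomial h j k a b Z = 0 := by
  have key := (measurePreserving_entrywiseRotation w).integral_comp'
    (gaussianMonomial h j k a b)
  have hneg : ∀ Z, gaussianMonomial h j k a b (entrywiseRotation w Z) =
      -gaussianMonomial h j k a b Z := by
    intro Z
    simp only [gaussianMonomial, hw, neg_mul, entrywiseRotation_apply, map_mul,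
      Circle.normSq_coe, one_mul]
  simp only [hneg, integral_neg] at key
  exact self_eq_neg.mp key.symm

lemma integral_gaussianMonomial_of_ne {h : ℝ} {j k : ℕ} {a b : Fin N} (hab : a ≠ b) :
    ∫ Z, gaussianMonomial h j k a b Z = 0 := by
  let d : Fin N → ℂ := fun p => if p = a then -1 else 1
  let u : Circle := Circle.exp Real.pi
  let w : Fin N → Fin N → Circle := fun p q => (if p = a then u else 1) * (if q = a then u else 1)
  have hu : (u : ℂ) = -1 := by simp [u, Circle.coe_exp]
  refine integral_gaussianMonomial_eq_zero_of_rotation w fun Z => ?_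
  have hd : diagonal d * diagonal d = 1 := by
    rw [diagonal_mul_diagonal, ← diagonal_one]
    congr 1; ext p; by_cases hp : p = a <;> simp [d, hp]
  have hdH : (diagonal d)ᴴ = diagonal d := by
    rw [diagonal_conjTranspose]
    congr 1; ext p; by_cases hp : p = a <;> simp [d, hp]
  have hZ : Matrix.of (entrywiseRotation w Z) = diagonal d * Matrix.of Z * diagonal d := by
    ext p q
    rw [mul_diagonal, diagonal_mul, of_apply, of_apply, entrywiseRotation_apply]
    by_cases hp : p = a <;> by_cases hq : q = a <;> simp [w, d, hp, hq, hu]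
  have hpow : ∀ (A : Matrix (Fin N) (Fin N) ℂ) (n : ℕ),
      (diagonal d * A * diagonal d) ^ n = diagonal d * A ^ n * diagonal d := by
    intro A n
    induction n with
    | zero => simp [hd]
    | succ n ih =>
      rw [pow_succ, ih, pow_succ]
      calc _ = diagonal d * A ^ n * (diagonal d * diagonal d) * A * diagonal d := by
            simp only [mul_assoc]
        _ = _ := by rw [hd]; simp only [mul_assoc, one_mul]
  have hH : (diagonal d * Matrix.of Z * diagonal d)ᴴ =
      diagonal d * (Matrix.of Z)ᴴ * diagonal d := by
    simp only [conjTranspose_mul, hdH, mul_assoc]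
  have hprod : ∀ A B : Matrix (Fin N) (Fin N) ℂ,
      (diagonal d * A * diagonal d) * (diagonal d * B * diagonal d) =
        diagonal d * (A * B) * diagonal d := by
    intro A B
    calc _ = diagonal d * A * (diagonal d * diagonal d) * B * diagonal d := by
            simp only [mul_assoc]
      _ = _ := by rw [hd]; simp only [mul_assoc, one_mul]
  rw [hZ, hH, hpow, hpow, hprod, mul_diagonal, diagonal_mul]
  simp [d, hab.symm]

lemma integral_gaussianMonomial_of_degree_ne {h : ℝ} {j k : ℕ} {a b : Fin N} (hjk : j ≠ k) :
    ∫ Z, gaussianMonomial h j k a b Z = 0 := by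
  let u : Circle := Circle.exp (Real.pi / ((k : ℝ) - j))
  have hne : (k : ℝ) - j ≠ 0 := sub_ne_zero.mpr (by exact_mod_cast hjk.symm)
  have hu : star (u : ℂ) ^ j * (u : ℂ) ^ k = -1 := by
    have h1 : star (u : ℂ) = ((Circle.exp (-(Real.pi / ((k : ℝ) - j))) : Circle) : ℂ) := by
      rw [Circle.exp_neg, Circle.coe_inv_eq_conj]; rfl
    rw [h1, Circle.coe_exp, Circle.coe_exp, ← Complex.exp_nat_mul, ← Complex.exp_nat_mul,
      ← Complex.exp_add, ← Complex.exp_pi_mul_I]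
    congr 1
    have hne' : (k : ℂ) - j ≠ 0 := by exact_mod_cast hne
    push_cast
    field_simp
    ring
  refine integral_gaussianMonomial_eq_zero_of_rotation (fun _ _ => u) fun Z => ?_
  have hZ : Matrix.of (entrywiseRotation (fun _ _ => u) Z) = (u : ℂ) • Matrix.of Z := by
    ext p q; rfl
  rw [hZ, conjTranspose_smul, smul_pow, smul_pow, smul_mul_smul_comm, hu]
  simp

lemma integral_gaussianMonomial_diag_eq (h : ℝ) (j k : ℕ) (a b : Fin N) :
    ∫ Z, gaussianMonomial h j k a a Z = ∫ Z, gaussianMonomial h j k b b Z := by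
  let σ := Equiv.swap a b
  rw [← (measurePreserving_simultaneousReindex σ).integral_comp' (gaussianMonomial h j k a a)]
  congr 1; ext Z
  have hZ : Matrix.of (simultaneousReindex σ Z) = reindexAlgEquiv ℂ ℂ σ (Matrix.of Z) := by
    ext p q; exact simultaneousReindex_apply σ Z p q
  have hH : (reindexAlgEquiv ℂ ℂ σ (Matrix.of Z))ᴴ = reindexAlgEquiv ℂ ℂ σ (Matrix.of Z)ᴴ := rfl
  have hS : ∑ p, ∑ q, Complex.normSq (simultaneousReindex σ Z p q) =
      ∑ p, ∑ q, Complex.normSq (Z p q) := by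
    simp only [simultaneousReindex_apply]
    rw [Equiv.sum_comp σ.symm (fun p => ∑ q, Complex.normSq (Z p (σ.symm q)))]
    exact Finset.sum_congr rfl fun p _ => Equiv.sum_comp σ.symm (fun q => Complex.normSq (Z p q))
  simp only [gaussianMonomial]
  rw [hS, hZ, hH, ← map_pow, ← map_pow, ← map_mul]
  simp [σ]

lemma isAddHaarMeasure_volume_matrix :
    (volume : Measure (Fin N → Fin N → ℂ)).IsAddHaarMeasure := by
  have h1 : (volume : Measure (Fin N → ℂ)).IsAddHaarMeasure :=
    Measure.pi.isAddHaarMeasure (fun _ : Fin N => (volume : Measure ℂ))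
  exact Measure.pi.isAddHaarMeasure (fun _ : Fin N => (volume : Measure (Fin N → ℂ)))

lemma integral_gaussianMonomial_scale {h : ℝ} (hh : 0 < h) (k : ℕ) (a b : Fin N) :
    ∫ Z, gaussianMonomial h k k a b Z = (h : ℂ) ^ k * ∫ Z, gaussianMonomial 1 k k a b Z := by
  have hs : 0 < √h := Real.sqrt_pos.mpr hh
  have hsq : √h ^ 2 = h := Real.sq_sqrt hh.le
  have := isAddHaarMeasure_volume_matrix (N := N)
  have key := Measure.integral_comp_smul (volume : Measure (Fin N → Fin N → ℂ))
    (gaussianMonomial h k k a b) √h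
  have hdim : Module.finrank ℝ (Fin N → Fin N → ℂ) = 2 * N ^ 2 := by
    simp [Module.finrank_pi_fintype, Complex.finrank_real_complex]; ring
  have hpt : ∀ Z, gaussianMonomial h k k a b (√h • Z) =
      ((h : ℂ) ^ k * ((h : ℂ) ^ (N ^ 2))⁻¹) * gaussianMonomial 1 k k a b Z := by
    intro Z
    have hZ : Matrix.of (√h • Z) = (√h : ℂ) • Matrix.of Z := by
      ext p q; simp
    have hS : ∑ p, ∑ q, Complex.normSq ((√h • Z) p q) = h * ∑ p, ∑ q, Complex.normSq (Z p q) := by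
      simp only [Finset.mul_sum]
      refine Finset.sum_congr rfl fun p _ => Finset.sum_congr rfl fun q _ => ?_
      simp [Complex.normSq_mul, hh.le]
    have hc : star (√h : ℂ) ^ k * (√h : ℂ) ^ k = (h : ℂ) ^ k := by
      rw [← mul_pow, Complex.star_def, Complex.conj_ofReal, ← sq, ← Complex.ofReal_pow, hsq]
    have he : -(h * ∑ p, ∑ q, Complex.normSq (Z p q)) / h =
        -(∑ p, ∑ q, Complex.normSq (Z p q)) / 1 := by
      field_simp
    simp only [gaussianMonomial]
    rw [hS, hZ, conjTranspose_smul, smul_pow, smul_pow, smul_mul_smul_comm, hc, he]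
    simp only [Matrix.smul_apply, smul_eq_mul, mul_pow, mul_one]
    push_cast
    rw [mul_inv]
    ring
  rw [hdim, pow_mul, hsq, abs_of_pos (by positivity)] at key
  simp only [hpt, integral_const_mul] at key
  rw [Complex.real_smul] at key
  push_cast at key
  have hh' : ((h : ℂ) ^ (N ^ 2)) ≠ 0 := pow_ne_zero _ (by exact_mod_cast hh.ne')
  field_simp at key
  exact key.symm

lemma conjTranspose_pow_mul_pow_diag (Z : Matrix (Fin N) (Fin N) ℂ) (k : ℕ) (a : Fin N) :
    (Zᴴ ^ k * Z ^ k) a a = ((∑ i, Complex.normSq ((Z ^ k) i a) : ℝ) : ℂ) := by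
  rw [← conjTranspose_pow, mul_apply, Complex.ofReal_sum]
  refine Finset.sum_congr rfl fun i _ => ?_
  rw [conjTranspose_apply, Complex.star_def, Complex.normSq_eq_conj_mul_self]

lemma sum_normSq_pow_col_le (Z : Matrix (Fin N) (Fin N) ℂ) (k : ℕ) (a : Fin N) :
    ∑ i, Complex.normSq ((Z ^ k) i a) ≤ (∑ p, ∑ q, Complex.normSq (Z p q)) ^ k := by
  induction k with
  | zero => simp [one_apply, apply_ite]
  | succ k ih =>
    have hrow : ∀ i, Complex.normSq ((Z ^ (k + 1)) i a) ≤
        (∑ q, Complex.normSq (Z i q)) * ∑ q, Complex.normSq ((Z ^ k) q a) := by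
      intro i
      rw [pow_succ', mul_apply]
      simp only [Complex.normSq_eq_norm_sq]
      calc _ ≤ (∑ q, ‖Z i q‖ * ‖(Z ^ k) q a‖) ^ 2 := by
            gcongr
            refine (norm_sum_le _ _).trans_eq ?_
            simp only [norm_mul]
        _ ≤ _ := Finset.sum_mul_sq_le_sq_mul_sq _ _ _
    calc _ ≤ ∑ i, (∑ q, Complex.normSq (Z i q)) * ∑ q, Complex.normSq ((Z ^ k) q a) :=
          Finset.sum_le_sum fun i _ => hrow i
      _ = (∑ p, ∑ q, Complex.normSq (Z p q)) * ∑ q, Complex.normSq ((Z ^ k) q a) := by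
          rw [Finset.sum_mul]
      _ ≤ _ := by
          rw [pow_succ']
          gcongr
          exact Finset.sum_nonneg fun p _ => Finset.sum_nonneg fun q _ => Complex.normSq_nonneg _

lemma integrable_exp_neg_half_sum_normSq :
    Integrable fun Z : Fin N → Fin N → ℂ =>
      Real.exp (-(∑ p, ∑ q, Complex.normSq (Z p q)) / 2) := by
  have h1 : Integrable fun z : ℂ => Real.exp (-Complex.normSq z / 2) := by
    have := (GaussianFourier.integrable_cexp_neg_mul_sq_norm_add (V := ℂ)
      (b := (1 / 2 : ℂ)) (by norm_num) 0 0).norm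
    refine this.congr (Filter.Eventually.of_forall fun z => ?_)
    simp only [Complex.norm_exp, Complex.normSq_eq_norm_sq]
    congr 1
    simp [← Complex.ofReal_pow]
    ring
  have h2 : Integrable fun z : Fin N → ℂ => ∏ q, Real.exp (-Complex.normSq (z q) / 2) :=
    Integrable.fintype_prod (μ := fun _ => volume)
      (f := fun _ z => Real.exp (-Complex.normSq z / 2)) fun _ => h1
  have h3 : Integrable fun Z : Fin N → Fin N → ℂ =>
      ∏ p, ∏ q, Real.exp (-Complex.normSq (Z p q) / 2) :=
    Integrable.fintype_prod (E := Fin N → ℂ) (μ := fun _ => volume)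
      (f := fun _ z => ∏ q, Real.exp (-Complex.normSq (z q) / 2)) fun _ => h2
  refine h3.congr (Filter.Eventually.of_forall fun Z => ?_)
  simp only [← Real.exp_sum, neg_div, Finset.sum_neg_distrib, Finset.sum_div]

lemma integral_sum_normSq_pow_col_mul_gaussian_pos (k : ℕ) (a : Fin N) :
    0 < ∫ Z : Fin N → Fin N → ℂ, (∑ i, Complex.normSq ((Matrix.of Z ^ k) i a)) *
      (((Real.pi * 1) ^ (N^2))⁻¹ * Real.exp (-(∑ p, ∑ q, Complex.normSq (Z p q)) / 1)) := by
  have hof : Continuous fun Z : Fin N → Fin N → ℂ => Matrix.of Z := continuous_id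
  have hcont : Continuous fun Z : Fin N → Fin N → ℂ =>
      (∑ i, Complex.normSq ((Matrix.of Z ^ k) i a)) *
      (((Real.pi * 1) ^ (N^2))⁻¹ *
        Real.exp (-(∑ p, ∑ q, Complex.normSq (Z p q)) / 1)) := by
    refine Continuous.mul (continuous_finsetSum _ fun i _ =>
      Complex.continuous_normSq.comp ((hof.pow k).matrix_elem i a)) ?_
    have : Continuous fun Z : Fin N → Fin N → ℂ => ∑ p, ∑ q, Complex.normSq (Z p q) :=
      continuous_finsetSum _ fun p _ => continuous_finsetSum _ fun q _ =>
        Complex.continuous_normSq.comp (by fun_prop)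
    fun_prop
  have hnonneg : ∀ Z : Fin N → Fin N → ℂ, 0 ≤ (∑ i, Complex.normSq ((Matrix.of Z ^ k) i a)) *
      (((Real.pi * 1) ^ (N^2))⁻¹ *
        Real.exp (-(∑ p, ∑ q, Complex.normSq (Z p q)) / 1)) := fun Z =>
    mul_nonneg (Finset.sum_nonneg fun _ _ => Complex.normSq_nonneg _) (by positivity)
  have hint : Integrable fun Z : Fin N → Fin N → ℂ =>
      (∑ i, Complex.normSq ((Matrix.of Z ^ k) i a)) *
      (((Real.pi * 1) ^ (N^2))⁻¹ *
        Real.exp (-(∑ p, ∑ q, Complex.normSq (Z p q)) / 1)) := by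
    refine ((integrable_exp_neg_half_sum_normSq (N := N)).const_mul
      (2 ^ k * k.factorial * ((Real.pi * 1) ^ (N^2))⁻¹)).mono' hcont.aestronglyMeasurable
      (Filter.Eventually.of_forall fun Z => ?_)
    rw [Real.norm_of_nonneg (hnonneg Z)]
    have hle := sum_normSq_pow_col_le (Matrix.of Z) k a
    simp only [of_apply] at hle
    have hS0 : 0 ≤ ∑ p, ∑ q, Complex.normSq (Z p q) :=
      Finset.sum_nonneg fun p _ => Finset.sum_nonneg fun q _ => Complex.normSq_nonneg _
    generalize (∑ p, ∑ q, Complex.normSq (Z p q)) = S at hle hS0 ⊢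
    have hexp := Real.pow_div_factorial_le_exp (S / 2) (by positivity) k
    have hpow : S ^ k ≤ 2 ^ k * k.factorial * Real.exp (S / 2) := by
      rw [div_pow, div_div, div_le_iff₀ (by positivity)] at hexp
      linarith
    have hE : Real.exp (-S / 1) = Real.exp (-S / 2) * Real.exp (-S / 2) := by
      rw [← Real.exp_add]; ring_nf
    have hE' : Real.exp (S / 2) * Real.exp (-S / 2) = 1 := by
      rw [← Real.exp_add]; ring_nf; exact Real.exp_zero
    calc _ ≤ (2 ^ k * k.factorial * Real.exp (S / 2)) *
          (((Real.pi * 1) ^ (N^2))⁻¹ * Real.exp (-S / 1)) := by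
          gcongr; exact hle.trans hpow
      _ = 2 ^ k * k.factorial * ((Real.pi * 1) ^ (N^2))⁻¹ * Real.exp (-S / 2) *
          (Real.exp (S / 2) * Real.exp (-S / 2)) := by rw [hE]; ring
      _ = _ := by rw [hE', mul_one]
  have := isAddHaarMeasure_volume_matrix (N := N)
  refine integral_pos_of_integrable_nonneg_nonzero (x := fun p q => (1 : Matrix _ _ ℂ) p q)
    hcont hint hnonneg ?_
  have h1 : Matrix.of (fun p q : Fin N => (1 : Matrix _ _ ℂ) p q) = 1 := rfl
  rw [h1, one_pow]
  refine mul_ne_zero ?_ (by positivity)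
  simp [one_apply, apply_ite]

lemma integral_gaussianMonomial_diag_one (k : ℕ) (a : Fin N) :
    ∫ Z, gaussianMonomial 1 k k a a Z =
      ((∫ Z : Fin N → Fin N → ℂ, (∑ i, Complex.normSq ((Matrix.of Z ^ k) i a)) *
        (((Real.pi * 1) ^ (N^2))⁻¹ *
          Real.exp (-(∑ p, ∑ q, Complex.normSq (Z p q)) / 1)) : ℝ) : ℂ) := by
  rw [← integral_complex_ofReal]
  simp only [gaussianMonomial, conjTranspose_pow_mul_pow_diag, Complex.ofReal_mul]

end GaussianMonomials

/-- For the Gaussian probability measure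
`dμ_h(Z) = e^{-Tr(Z*Z)/h} (πh)^{-N²} dZ` on `N×N` complex matrices, the monomial
matrix functions satisfy `∫ Z^{*j} Z^k dμ_h(Z) = δ_{jk} h^k c_k I` for some
positive constants `c_k` depending only on `k` and `N`. The matrix-valued
integral is taken entrywise. -/
theorem stmt_0 (N : ℕ) (hN : 0 < N) (k : ℕ) :
    ∃ c : ℝ, 0 < c ∧ ∀ h : ℝ, 0 < h → ∀ j : ℕ,
      (fun (a b : Fin N) => ∫ Z : Fin N → Fin N → ℂ,
          (((Matrix.of Z)ᴴ ^ j * (Matrix.of Z) ^ k) a b) *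
            Complex.ofReal (((Real.pi * h) ^ (N^2))⁻¹ *
              Real.exp (-(∑ p, ∑ q, Complex.normSq (Z p q)) / h)) ∂volume)
        = fun (a b : Fin N) =>
            (if j = k then ((h : ℂ)^k * (c : ℂ)) else 0) *
              (1 : Matrix (Fin N) (Fin N) ℂ) a b := by
  refine ⟨_, integral_sum_normSq_pow_col_mul_gaussian_pos k (⟨0, hN⟩ : Fin N), ?_⟩
  intro h hh j
  ext a b
  change ∫ Z, gaussianMonomial h j k a b Z = _
  by_cases hjk : j = k
  · subst hjk
    by_cases hab : a = b
    · subst hab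
      rw [integral_gaussianMonomial_diag_eq h j j a ⟨0, hN⟩, integral_gaussianMonomial_scale hh,
        integral_gaussianMonomial_diag_one, if_pos rfl, one_apply_eq]
      simp only [mul_one]
    · rw [integral_gaussianMonomial_of_ne hab, one_apply_ne hab, mul_zero]
  · rw [integral_gaussianMonomial_of_degree_ne hjk, if_neg hjk, zero_mul]
end

section
/- For the Gaussian measure μ_h on ℂ^{N×N}, the matrix-valued identity Δ^k(Y^{*k} Y^k)(0) = k! c_k I holds, where c_k is defined by ∫ Y^{*k} Y^k dμ_h(Y) = c_k h^k I and Δ = ∑_{j,l} ∂²/∂y_{jl}∂ȳ_{jl}. -/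
open MeasureTheory Matrix

/-- The complex Laplacian `Δ = ∑_{j,l} ∂²/∂y_{jl}∂ȳ_{jl}` on `ℂ^{N×N}`, expressed
as one quarter of the real Laplacian via second directional derivatives. -/
noncomputable def matrixLaplacian (N : ℕ) (f : (Fin N → Fin N → ℂ) → ℂ) :
    (Fin N → Fin N → ℂ) → ℂ := fun Z =>
  (1/4 : ℂ) * ∑ j : Fin N, ∑ l : Fin N,
    (iteratedDeriv 2 (fun t : ℝ => f (Z + t • (Pi.single j (Pi.single l (1:ℂ)) : Fin N → Fin N → ℂ))) 0 +
     iteratedDeriv 2 (fun t : ℝ => f (Z + t • (Pi.single j (Pi.single l Complex.I) : Fin N → Fin N → ℂ))) 0)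


open MvPolynomial in
theorem MvPolynomial.pderiv_pderiv_comm {R τ : Type*} [CommRing R] (i j : τ)
    (p : MvPolynomial τ R) : pderiv i (pderiv j p) = pderiv j (pderiv i p) := by
  classical
  have h : ⁅pderiv (R := R) i, pderiv (R := R) j⁆ = 0 := by
    refine MvPolynomial.derivation_ext fun k => ?_
    by_cases hi : k = i <;> by_cases hj : k = j <;>
      simp [Derivation.commutator_apply, pderiv_X, Pi.single_apply, apply_ite]
  have := congrArg (fun D => D p) h
  simpa [Derivation.commutator_apply, sub_eq_zero] using this

/-- The polynomial Laplacian `∑ i, ∂²/∂yᵢ∂ȳᵢ`, where `inl i` indexes `yᵢ` and `inr i`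
indexes `ȳᵢ`. -/
noncomputable def polyLaplacian (σ : Type*) [Fintype σ] :
    MvPolynomial (σ ⊕ σ) ℂ →ₗ[ℂ] MvPolynomial (σ ⊕ σ) ℂ :=
  ∑ i : σ, (MvPolynomial.pderiv (Sum.inl i)).toLinearMap ∘ₗ
    (MvPolynomial.pderiv (Sum.inr i)).toLinearMap

/-- The bidegree weights: `(1, 0)` for `y` and `(0, 1)` for `ȳ`. -/
def bidegreeWeight (σ : Type*) : σ ⊕ σ → ℕ × ℕ :=
  Sum.elim (fun _ => (1, 0)) (fun _ => (0, 1))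

section Algebra

open MvPolynomial

variable {σ : Type*} [Fintype σ]

theorem polyLaplacian_apply (p : MvPolynomial (σ ⊕ σ) ℂ) :
    polyLaplacian σ p = ∑ i, pderiv (Sum.inl i) (pderiv (Sum.inr i) p) := by
  simp [polyLaplacian]

theorem polyLaplacian_pderiv (j : σ ⊕ σ) (p : MvPolynomial (σ ⊕ σ) ℂ) :
    polyLaplacian σ (pderiv j p) = pderiv j (polyLaplacian σ p) := by
  simp only [polyLaplacian_apply, map_sum]
  refine Finset.sum_congr rfl fun i _ => ?_
  rw [pderiv_pderiv_comm (Sum.inr i) j, pderiv_pderiv_comm (Sum.inl i) j]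

theorem polyLaplacian_X_mul (i : σ) (p : MvPolynomial (σ ⊕ σ) ℂ) :
    polyLaplacian σ (X (Sum.inl i) * p) =
      X (Sum.inl i) * polyLaplacian σ p + pderiv (Sum.inr i) p := by
  classical
  simp only [polyLaplacian_apply, pderiv_mul, pderiv_X, Pi.single_apply, Sum.inl.injEq,
    reduceCtorEq, if_false, zero_mul, zero_add, Finset.sum_add_distrib, Finset.mul_sum]
  rw [add_comm]
  simp

theorem polyLaplacian_pow_pderiv (k : ℕ) (j : σ ⊕ σ) (p : MvPolynomial (σ ⊕ σ) ℂ) :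
    (polyLaplacian σ ^ k) (pderiv j p) = pderiv j ((polyLaplacian σ ^ k) p) := by
  induction k with
  | zero => simp
  | succ k ih => rw [pow_succ', Module.End.mul_apply, ih, polyLaplacian_pderiv]; rfl

theorem polyLaplacian_pow_X_mul (k : ℕ) (i : σ) (p : MvPolynomial (σ ⊕ σ) ℂ) :
    (polyLaplacian σ ^ (k + 1)) (X (Sum.inl i) * p) =
      X (Sum.inl i) * (polyLaplacian σ ^ (k + 1)) p +
        (k + 1 : ℂ) • (polyLaplacian σ ^ k) (pderiv (Sum.inr i) p) := by
  induction k with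
  | zero => simp [polyLaplacian_X_mul]
  | succ k ih =>
    rw [pow_succ', Module.End.mul_apply, ih, map_add, map_smul, polyLaplacian_X_mul,
      ← polyLaplacian_pow_pderiv, ← Module.End.mul_apply, ← Module.End.mul_apply, ← pow_succ',
      ← pow_succ', add_assoc]
    push_cast
    module

/-- A normalized linear functional satisfying the Gaussian integration by parts formula agrees, on
polynomials of bidegree `(k, k)`, with `Δᵏ / k!` at the origin. -/
theorem constantCoeff_polyLaplacian_pow {E : MvPolynomial (σ ⊕ σ) ℂ →ₗ[ℂ] ℂ} (h_one : E 1 = 1)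
    (h_parts : ∀ i p, E (X (Sum.inl i) * p) = E (pderiv (Sum.inr i) p)) (k : ℕ)
    {p : MvPolynomial (σ ⊕ σ) ℂ} (hp : IsWeightedHomogeneous (bidegreeWeight σ) p (k, k)) :
    constantCoeff ((polyLaplacian σ ^ k) p) = k.factorial * E p := by
  induction k generalizing p with
  | zero =>
    obtain ⟨c, rfl⟩ : ∃ c, p = C c := by
      refine ⟨coeff 0 p, hp.eq_monomial_of_unique_weight fun m hm => ?_⟩
      ext (i | i)
      · have := congrArg Prod.fst hm
        simp [Finsupp.weight_apply, Finsupp.sum_fintype, bidegreeWeight, Prod.fst_sum] at this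
        simpa using this i
      · have := congrArg Prod.snd hm
        simp [Finsupp.weight_apply, Finsupp.sum_fintype, bidegreeWeight, Prod.snd_sum] at this
        simpa using this i
    rw [C_eq_smul_one]
    simp [h_one]
  | succ k ih =>
    refine IsWeightedHomogeneous.induction_on
      (motive := fun p _ => constantCoeff ((polyLaplacian σ ^ (k + 1)) p) = (k + 1).factorial * E p)
      (by simp) (fun p q _ _ hp hq => by simp only [map_add, hp, hq, mul_add])
      (fun m c hm => ?_) hp
    obtain ⟨i, hi⟩ : ∃ i, m (Sum.inl i) ≠ 0 := by
      by_contra! h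
      have := congrArg Prod.fst hm
      simp [Finsupp.weight_apply, Finsupp.sum_fintype, bidegreeWeight, h, Prod.fst_sum] at this
    obtain ⟨m, rfl⟩ : ∃ m', m = m' + Finsupp.single (Sum.inl i) 1 :=
      ⟨m - Finsupp.single (Sum.inl i) 1,
        (tsub_add_cancel_of_le (Finsupp.single_le_iff.2 (Nat.one_le_iff_ne_zero.2 hi))).symm⟩
    have hm' : Finsupp.weight (bidegreeWeight σ) m = (k, k) + bidegreeWeight σ (Sum.inr i) := by
      rw [map_add, Finsupp.weight_single, one_smul] at hm
      refine add_right_cancel (b := bidegreeWeight σ (Sum.inl i)) (hm.trans ?_)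
      simp [bidegreeWeight]
    have h_eq : monomial (m + Finsupp.single (Sum.inl i) 1) c =
        X (Sum.inl i) * monomial m c := by
      rw [X, monomial_mul, one_mul, add_comm]
    rw [h_eq, polyLaplacian_pow_X_mul, h_parts, map_add, map_mul, constantCoeff_X, zero_mul,
      zero_add, constantCoeff_smul, smul_eq_mul,
      ih ((isWeightedHomogeneous_monomial _ m c hm').pderiv rfl), Nat.factorial_succ]
    push_cast
    ring

end Algebra

/-- The value of a polynomial in `y, ȳ` at a matrix. -/
noncomputable def matrixEval {N : ℕ} (Y : Fin N → Fin N → ℂ) :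
    MvPolynomial ((Fin N × Fin N) ⊕ (Fin N × Fin N)) ℂ →+* ℂ :=
  MvPolynomial.eval (Sum.elim (fun i => Y i.1 i.2) (fun i => star (Y i.1 i.2)))

section Derivatives

open MvPolynomial

variable {N : ℕ}

theorem hasDerivAt_matrixEval (Z : Fin N → Fin N → ℂ) (j l : Fin N) (v : ℂ)
    (p : MvPolynomial ((Fin N × Fin N) ⊕ (Fin N × Fin N)) ℂ) (t : ℝ) :
    HasDerivAt (fun t : ℝ =>
        matrixEval (Z + t • (Pi.single j (Pi.single l v) : Fin N → Fin N → ℂ)) p)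
      (matrixEval (Z + t • (Pi.single j (Pi.single l v) : Fin N → Fin N → ℂ))
        (C v * pderiv (Sum.inl (j, l)) p + C (star v) * pderiv (Sum.inr (j, l)) p)) t := by
  induction p using MvPolynomial.induction_on with
  | C a => simpa [matrixEval] using hasDerivAt_const t a
  | add p q hp hq =>
    refine ((hp.add hq).congr_of_eventuallyEq (.of_forall fun t => map_add _ p q)).congr_deriv ?_
    simp only [map_add, map_mul]
    ring
  | mul_X p i hp =>
    have h_entry : ∀ r s, HasDerivAt (fun t : ℝ =>
        (Z + t • (Pi.single j (Pi.single l v) : Fin N → Fin N → ℂ)) r s)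
        ((Pi.single j (Pi.single l v) : Fin N → Fin N → ℂ) r s) t := by
      intro r s
      have := ((hasDerivAt_id t).smul_const
        ((Pi.single j (Pi.single l v) : Fin N → Fin N → ℂ) r s)).const_add (Z r s)
      simpa using this
    have h_X : HasDerivAt (fun t : ℝ =>
        matrixEval (Z + t • (Pi.single j (Pi.single l v) : Fin N → Fin N → ℂ)) (X i))
        (matrixEval (Z + t • (Pi.single j (Pi.single l v) : Fin N → Fin N → ℂ))
          (C v * pderiv (Sum.inl (j, l)) (X i) + C (star v) * pderiv (Sum.inr (j, l)) (X i))) t := by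
      rcases i with ⟨r, s⟩ | ⟨r, s⟩
      · refine ((h_entry r s).congr_of_eventuallyEq
          (.of_forall fun t => by simp [matrixEval])).congr_deriv ?_
        by_cases h₁ : r = j <;> by_cases h₂ : s = l <;>
          simp [matrixEval, pderiv_X, Pi.single_apply, h₁, h₂]
      · refine ((h_entry r s).star.congr_of_eventuallyEq
          (.of_forall fun t => by simp [matrixEval])).congr_deriv ?_
        by_cases h₁ : r = j <;> by_cases h₂ : s = l <;>
          simp [matrixEval, pderiv_X, Pi.single_apply, h₁, h₂]
    refine ((hp.mul h_X).congr_of_eventuallyEq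
      (.of_forall fun t => map_mul _ p (X i))).congr_deriv ?_
    simp only [map_add, map_mul, pderiv_mul]
    ring

theorem iteratedDeriv_two_matrixEval (Z : Fin N → Fin N → ℂ) (j l : Fin N) (v : ℂ)
    (p : MvPolynomial ((Fin N × Fin N) ⊕ (Fin N × Fin N)) ℂ) :
    iteratedDeriv 2 (fun t : ℝ =>
        matrixEval (Z + t • (Pi.single j (Pi.single l v) : Fin N → Fin N → ℂ)) p) 0 =
      v ^ 2 * matrixEval Z (pderiv (Sum.inl (j, l)) (pderiv (Sum.inl (j, l)) p)) +
      2 * (v * star v) * matrixEval Z (pderiv (Sum.inl (j, l)) (pderiv (Sum.inr (j, l)) p)) +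
      star v ^ 2 * matrixEval Z (pderiv (Sum.inr (j, l)) (pderiv (Sum.inr (j, l)) p)) := by
  rw [iteratedDeriv_succ, iteratedDeriv_one,
    funext fun t => (hasDerivAt_matrixEval Z j l v p t).deriv, (hasDerivAt_matrixEval ..).deriv]
  have h_C (a : ℂ) : matrixEval Z (C a) = a := by simp [matrixEval]
  simp only [zero_smul, add_zero, map_add, map_mul, pderiv_C_mul, h_C,
    pderiv_pderiv_comm (Sum.inr (j, l)) (Sum.inl (j, l))]
  ring

theorem matrixLaplacian_matrixEval (p : MvPolynomial ((Fin N × Fin N) ⊕ (Fin N × Fin N)) ℂ) :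
    matrixLaplacian N (fun Y => matrixEval Y p) =
      fun Y => matrixEval Y (polyLaplacian (Fin N × Fin N) p) := by
  ext Z
  simp only [matrixLaplacian, iteratedDeriv_two_matrixEval, polyLaplacian_apply, map_sum,
    Fintype.sum_prod_type, Finset.mul_sum]
  refine Finset.sum_congr rfl fun j _ => Finset.sum_congr rfl fun l _ => ?_
  simp only [star_one, Complex.star_def, Complex.conj_I, Complex.I_sq, mul_neg, Complex.I_mul_I,
    neg_sq]
  ring

theorem matrixLaplacian_iterate_matrixEval (k : ℕ)
    (p : MvPolynomial ((Fin N × Fin N) ⊕ (Fin N × Fin N)) ℂ) :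
    (matrixLaplacian N)^[k] (fun Y => matrixEval Y p) =
      fun Y => matrixEval Y ((polyLaplacian (Fin N × Fin N) ^ k) p) := by
  induction k generalizing p with
  | zero => rfl
  | succ k ih => rw [Function.iterate_succ_apply, matrixLaplacian_matrixEval, ih, pow_succ]; rfl

theorem matrixEval_zero (p : MvPolynomial ((Fin N × Fin N) ⊕ (Fin N × Fin N)) ℂ) :
    matrixEval 0 p = constantCoeff p := by
  have h : (Sum.elim (fun i => (0 : Fin N → Fin N → ℂ) i.1 i.2)
      (fun i => star ((0 : Fin N → Fin N → ℂ) i.1 i.2)) : (Fin N × Fin N) ⊕ (Fin N × Fin N) → ℂ) =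
      0 := by
    ext (i | i) <;> simp
  rw [matrixEval, h, eval_zero]

end Derivatives

/-- The entries of `Y^{*k} Y^k` are polynomials of bidegree `(k, k)` in the entries of `Y, Ȳ`. -/
theorem exists_matrixEval_eq (N k : ℕ) (a b : Fin N) :
    ∃ p : MvPolynomial ((Fin N × Fin N) ⊕ (Fin N × Fin N)) ℂ,
      p.IsWeightedHomogeneous (bidegreeWeight (Fin N × Fin N)) (k, k) ∧
      ∀ Y : Fin N → Fin N → ℂ,
        ((Matrix.of Y)ᴴ ^ k * (Matrix.of Y) ^ k) a b = matrixEval Y p := by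
  obtain ⟨A, hA⟩ : ∃ A : Matrix (Fin N) (Fin N)
      (MvPolynomial ((Fin N × Fin N) ⊕ (Fin N × Fin N)) ℂ),
      ∀ i j, A i j = MvPolynomial.X (Sum.inr (j, i)) := ⟨fun _ _ => _, fun _ _ => rfl⟩
  obtain ⟨B, hB⟩ : ∃ B : Matrix (Fin N) (Fin N)
      (MvPolynomial ((Fin N × Fin N) ⊕ (Fin N × Fin N)) ℂ),
      ∀ i j, B i j = MvPolynomial.X (Sum.inl (i, j)) := ⟨fun _ _ => _, fun _ _ => rfl⟩
  have h_pow (M : Matrix (Fin N) (Fin N) (MvPolynomial ((Fin N × Fin N) ⊕ (Fin N × Fin N)) ℂ))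
      (d : ℕ × ℕ) (hM : ∀ i j, (M i j).IsWeightedHomogeneous (bidegreeWeight (Fin N × Fin N)) d)
      (n : ℕ) (i j : Fin N) :
      ((M ^ n) i j).IsWeightedHomogeneous (bidegreeWeight (Fin N × Fin N)) (n • d) := by
    induction n generalizing i j with
    | zero =>
      rw [pow_zero, Matrix.one_apply, zero_smul]
      split_ifs
      · exact MvPolynomial.isWeightedHomogeneous_one ..
      · exact MvPolynomial.isWeightedHomogeneous_zero ..
    | succ n ih =>
      rw [pow_succ, Matrix.mul_apply, succ_nsmul]
      exact .sum _ _ _ fun s _ => (ih i s).mul (hM s j)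
  refine ⟨(A ^ k * B ^ k) a b, ?_, fun Y => ?_⟩
  · rw [Matrix.mul_apply]
    have h_deg : ((k, k) : ℕ × ℕ) = k • (0, 1) + k • (1, 0) := by simp
    rw [h_deg]
    exact .sum _ _ _ fun s _ =>
      (h_pow A _ (fun i j => hA i j ▸ MvPolynomial.isWeightedHomogeneous_X ..) k a s).mul
        (h_pow B _ (fun i j => hB i j ▸ MvPolynomial.isWeightedHomogeneous_X ..) k s b)
  · have h_A : (matrixEval Y).mapMatrix A = (Matrix.of Y)ᴴ := by
      ext i j; simp [hA, matrixEval]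
    have h_B : (matrixEval Y).mapMatrix B = Matrix.of Y := by
      ext i j; simp [hB, matrixEval]
    rw [← h_A, ← h_B, ← map_pow (matrixEval Y).mapMatrix, ← map_pow (matrixEval Y).mapMatrix,
      ← map_mul (matrixEval Y).mapMatrix]
    rfl

/-- The moments `∫ zᵃ z̄ᵇ π⁻¹ e^{-|z|²} dz` of the standard complex Gaussian. -/
noncomputable def gaussianMoment (a b : ℕ) : ℂ := if a = b then (a.factorial : ℂ) else 0

theorem integral_norm_pow_mul_gaussian (n : ℕ) :
    ∫ z : ℂ, ‖z‖ ^ n * (Real.pi⁻¹ * Real.exp (-Complex.normSq z)) = Real.Gamma ((n + 2) / 2) := by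
  have h := Complex.integral_rpow_mul_exp_neg_rpow (p := 2) (q := n) (by norm_num)
    (by have : (0 : ℝ) ≤ n := n.cast_nonneg
        linarith)
  simp_rw [mul_left_comm (‖_‖ ^ n)]
  rw [integral_const_mul]
  simp only [Real.rpow_natCast, Real.rpow_ofNat, ← Complex.normSq_eq_norm_sq] at h
  rw [h]
  field_simp [Real.pi_ne_zero]

theorem integrable_gaussian_monomial (a b : ℕ) :
    Integrable fun z : ℂ =>
      z ^ a * star z ^ b * ((Real.pi⁻¹ * Real.exp (-Complex.normSq z) : ℝ) : ℂ) := by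
  have h : Integrable fun z : ℂ =>
      ‖z‖ ^ (a + b) * (Real.pi⁻¹ * Real.exp (-Complex.normSq z)) := by
    refine Integrable.of_integral_ne_zero ?_
    rw [integral_norm_pow_mul_gaussian]
    exact (Real.Gamma_pos_of_pos (by positivity)).ne'
  have h_cont : Continuous fun z : ℂ =>
      z ^ a * star z ^ b * ((Real.pi⁻¹ * Real.exp (-Complex.normSq z) : ℝ) : ℂ) := by
    have := Complex.continuous_normSq
    fun_prop
  refine h.mono' h_cont.aestronglyMeasurable (Filter.Eventually.of_forall fun z => ?_)
  have h_nonneg : 0 ≤ Real.pi⁻¹ * Real.exp (-Complex.normSq z) := by positivity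
  rw [norm_mul, norm_mul, norm_pow, norm_pow, norm_star, ← pow_add, Complex.norm_real,
    Real.norm_of_nonneg h_nonneg]

theorem integral_gaussian_monomial (a b : ℕ) :
    ∫ z : ℂ, z ^ a * star z ^ b * ((Real.pi⁻¹ * Real.exp (-Complex.normSq z) : ℝ) : ℂ) =
      gaussianMoment a b := by
  rcases eq_or_ne a b with rfl | hab
  · have h (z : ℂ) : z ^ a * star z ^ a * ((Real.pi⁻¹ * Real.exp (-Complex.normSq z) : ℝ) : ℂ) =
        ((‖z‖ ^ (2 * a) * (Real.pi⁻¹ * Real.exp (-Complex.normSq z)) : ℝ) : ℂ) := by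
      rw [← mul_pow, Complex.star_def, Complex.mul_conj, Complex.normSq_eq_norm_sq]
      push_cast
      ring
    simp_rw [h]
    rw [integral_complex_ofReal, integral_norm_pow_mul_gaussian, gaussianMoment, if_pos rfl]
    have : (((2 * a : ℕ) : ℝ) + 2) / 2 = a + 1 := by push_cast; ring
    rw [this, Real.Gamma_nat_eq_factorial]
    simp
  · rw [gaussianMoment, if_neg hab]
    set w : Circle := Circle.exp (Real.pi / ((a : ℝ) - b)) with hw
    have hab' : (a : ℂ) - b ≠ 0 := sub_ne_zero.2 (by exact_mod_cast hab)
    have h_w : (w : ℂ) ^ a * star (w : ℂ) ^ b = -1 := by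
      rw [hw, Complex.star_def, Circle.coe_exp, ← Complex.exp_conj, ← Complex.exp_nat_mul,
        ← Complex.exp_nat_mul, ← Complex.exp_add, ← Complex.exp_pi_mul_I]
      congr 1
      simp only [map_mul, Complex.conj_ofReal, Complex.conj_I]
      push_cast
      field_simp
      ring
    have h_rot := (rotation w).measurePreserving.integral_comp
      (rotation w).toHomeomorph.measurableEmbedding
      (fun z : ℂ => z ^ a * star z ^ b * ((Real.pi⁻¹ * Real.exp (-Complex.normSq z) : ℝ) : ℂ))
    have h_neg (z : ℂ) : (rotation w z) ^ a * star (rotation w z) ^ b *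
        ((Real.pi⁻¹ * Real.exp (-Complex.normSq (rotation w z)) : ℝ) : ℂ) =
        -(z ^ a * star z ^ b * ((Real.pi⁻¹ * Real.exp (-Complex.normSq z) : ℝ) : ℂ)) := by
      have : Complex.normSq (rotation w z) = Complex.normSq z := by
        rw [rotation_apply, map_mul, Circle.normSq_coe, one_mul]
      rw [this, rotation_apply, star_mul', mul_pow, mul_pow, mul_mul_mul_comm, h_w]
      ring
    simp_rw [h_neg, integral_neg] at h_rot
    exact self_eq_neg.1 h_rot.symm

/-- The complex Gaussian functional on polynomials in `y, ȳ`, defined by its values on monomials. -/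
noncomputable def gaussianFunctional (σ : Type*) [Fintype σ] :
    MvPolynomial (σ ⊕ σ) ℂ →ₗ[ℂ] ℂ :=
  (MvPolynomial.basisMonomials (σ ⊕ σ) ℂ).constr ℂ
    fun m => ∏ i, gaussianMoment (m (Sum.inl i)) (m (Sum.inr i))

section Functional

open MvPolynomial

variable {σ : Type*} [Fintype σ]

theorem gaussianFunctional_monomial (m : σ ⊕ σ →₀ ℕ) (c : ℂ) :
    gaussianFunctional σ (monomial m c) =
      c * ∏ i, gaussianMoment (m (Sum.inl i)) (m (Sum.inr i)) := by
  have h : monomial m c = c • basisMonomials (σ ⊕ σ) ℂ m := by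
    simp [smul_monomial]
  rw [h, map_smul, gaussianFunctional, Module.Basis.constr_basis, smul_eq_mul]

theorem gaussianFunctional_one : gaussianFunctional σ 1 = 1 := by
  rw [← C_1, C_apply, gaussianFunctional_monomial]
  simp [gaussianMoment]

theorem gaussianMoment_succ_left (a b : ℕ) :
    gaussianMoment (a + 1) b = b * gaussianMoment a (b - 1) := by
  cases b with
  | zero => simp [gaussianMoment]
  | succ b =>
    by_cases h : a = b
    · simp [gaussianMoment, h, Nat.factorial_succ]
    · simp [gaussianMoment, h]

theorem gaussianFunctional_X_mul (i : σ) (p : MvPolynomial (σ ⊕ σ) ℂ) :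
    gaussianFunctional σ (X (Sum.inl i) * p) =
      gaussianFunctional σ (pderiv (Sum.inr i) p) := by
  classical
  induction p using MvPolynomial.induction_on' with
  | add p q hp hq => rw [mul_add, map_add, map_add, map_add, hp, hq]
  | monomial m c =>
    rw [X, monomial_mul, one_mul, pderiv_monomial, gaussianFunctional_monomial,
      gaussianFunctional_monomial, mul_assoc, ← Finset.mul_prod_erase _ _ (Finset.mem_univ i),
      ← Finset.mul_prod_erase _ _ (Finset.mem_univ i), ← mul_assoc (m (Sum.inr i) : ℂ)]
    congr 2
    · simp [add_comm 1, gaussianMoment_succ_left]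
    · refine Finset.prod_congr rfl fun j hj => ?_
      have hji : i ≠ j := (Finset.ne_of_mem_erase hj).symm
      simp [hji]

end Functional

/-- The standard Gaussian density on `N × N` complex matrices. -/
noncomputable def matrixGaussian {N : ℕ} (Y : Fin N → Fin N → ℂ) : ℂ :=
  ∏ j, ∏ l, ((Real.pi⁻¹ * Real.exp (-Complex.normSq (Y j l)) : ℝ) : ℂ)

theorem matrixGaussian_eq {N : ℕ} (Y : Fin N → Fin N → ℂ) :
    matrixGaussian Y = Complex.ofReal (((Real.pi * 1) ^ (N ^ 2))⁻¹ *
      Real.exp (-(∑ p, ∑ q, Complex.normSq (Y p q)) / 1)) := by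
  rw [matrixGaussian]
  simp_rw [← Complex.ofReal_prod]
  congr 1
  simp_rw [Finset.prod_mul_distrib, ← Real.exp_sum, Finset.sum_neg_distrib]
  simp [← pow_mul, sq]

theorem matrixEval_monomial_mul_matrixGaussian {N : ℕ}
    (m : (Fin N × Fin N) ⊕ (Fin N × Fin N) →₀ ℕ) (c : ℂ) (Y : Fin N → Fin N → ℂ) :
    matrixEval Y (MvPolynomial.monomial m c) * matrixGaussian Y =
      c * ∏ j, ∏ l, (Y j l ^ m (Sum.inl (j, l)) * star (Y j l) ^ m (Sum.inr (j, l)) *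
        ((Real.pi⁻¹ * Real.exp (-Complex.normSq (Y j l)) : ℝ) : ℂ)) := by
  rw [matrixEval, MvPolynomial.eval_monomial, Finsupp.prod_fintype _ _ (by simp),
    Fintype.prod_sum_type, Fintype.prod_prod_type, Fintype.prod_prod_type, matrixGaussian]
  simp only [Sum.elim_inl, Sum.elim_inr, Finset.prod_mul_distrib]
  ring

theorem integrable_matrixEval_mul_matrixGaussian {N : ℕ}
    (p : MvPolynomial ((Fin N × Fin N) ⊕ (Fin N × Fin N)) ℂ) :
    Integrable fun Y : Fin N → Fin N → ℂ => matrixEval Y p * matrixGaussian Y := by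
  induction p using MvPolynomial.induction_on' with
  | add p q hp hq =>
    simp only [map_add, add_mul]
    exact hp.add hq
  | monomial m c =>
    simp_rw [matrixEval_monomial_mul_matrixGaussian]
    refine Integrable.const_mul ?_ c
    exact Integrable.fintype_prod_dep (μ := fun _ => volume) (f := fun j (y : Fin N → ℂ) =>
        ∏ l, (y l ^ m (Sum.inl (j, l)) * star (y l) ^ m (Sum.inr (j, l)) *
          ((Real.pi⁻¹ * Real.exp (-Complex.normSq (y l)) : ℝ) : ℂ))) fun j =>
      Integrable.fintype_prod_dep (μ := fun _ => volume) (f := fun l (z : ℂ) =>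
        z ^ m (Sum.inl (j, l)) * star z ^ m (Sum.inr (j, l)) *
          ((Real.pi⁻¹ * Real.exp (-Complex.normSq z) : ℝ) : ℂ)) fun l =>
      integrable_gaussian_monomial _ _

theorem integral_matrixEval_mul_matrixGaussian {N : ℕ}
    (p : MvPolynomial ((Fin N × Fin N) ⊕ (Fin N × Fin N)) ℂ) :
    ∫ Y : Fin N → Fin N → ℂ, matrixEval Y p * matrixGaussian Y =
      gaussianFunctional (Fin N × Fin N) p := by
  induction p using MvPolynomial.induction_on' with
  | add p q hp hq =>
    simp only [map_add, add_mul]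
    rw [integral_add (integrable_matrixEval_mul_matrixGaussian p)
      (integrable_matrixEval_mul_matrixGaussian q), hp, hq]
  | monomial m c =>
    simp_rw [matrixEval_monomial_mul_matrixGaussian]
    rw [integral_const_mul, gaussianFunctional_monomial, Fintype.prod_prod_type,
      integral_fintype_prod_volume_eq_prod (fun j (y : Fin N → ℂ) =>
        ∏ l, (y l ^ m (Sum.inl (j, l)) * star (y l) ^ m (Sum.inr (j, l)) *
          ((Real.pi⁻¹ * Real.exp (-Complex.normSq (y l)) : ℝ) : ℂ)))]
    congr 1
    refine Finset.prod_congr rfl fun j _ => ?_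
    rw [integral_fintype_prod_volume_eq_prod (fun l (z : ℂ) =>
        z ^ m (Sum.inl (j, l)) * star z ^ m (Sum.inr (j, l)) *
          ((Real.pi⁻¹ * Real.exp (-Complex.normSq z) : ℝ) : ℂ))]
    exact Finset.prod_congr rfl fun l _ => integral_gaussian_monomial _ _

/-- If `c_k` is defined by the Gaussian moment identity
`∫ Y^{*k} Y^k dμ_h(Y) = c_k h^k I`, then `Δ^k(Y^{*k} Y^k)(0) = k! c_k I`
(entrywise). -/
theorem stmt_10 (N : ℕ) (hN : 0 < N) (k : ℕ) (c : ℝ)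
    (hc : ∀ h : ℝ, 0 < h → ∀ a b : Fin N,
      (∫ Y : Fin N → Fin N → ℂ,
          (((Matrix.of Y)ᴴ ^ k * (Matrix.of Y) ^ k) a b) *
            Complex.ofReal (((Real.pi * h) ^ (N^2))⁻¹ *
              Real.exp (-(∑ p, ∑ q, Complex.normSq (Y p q)) / h)) ∂volume)
        = (c : ℂ) * (h : ℂ)^k * (1 : Matrix (Fin N) (Fin N) ℂ) a b) :
    ∀ a b : Fin N,
      (matrixLaplacian N)^[k] (fun Y => ((Matrix.of Y)ᴴ ^ k * (Matrix.of Y) ^ k) a b) 0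
        = (k.factorial : ℂ) * (c : ℂ) * (1 : Matrix (Fin N) (Fin N) ℂ) a b := by
  intro a b
  obtain ⟨p, hp, hpY⟩ := exists_matrixEval_eq N k a b
  have h := hc 1 one_pos a b
  simp_rw [← matrixGaussian_eq, hpY, integral_matrixEval_mul_matrixGaussian] at h
  simp_rw [hpY, matrixLaplacian_iterate_matrixEval, matrixEval_zero]
  rw [constantCoeff_polyLaplacian_pow gaussianFunctional_one gaussianFunctional_X_mul k hp, h]
  simp [mul_assoc]
end
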